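/- Every cancellative cone admits a unitary embedding into a cancellative normally divisible refinement cone, and also a strongly unitary embedding into a cancellative refinement cone. -/

import Mathlib

universe u

/-- Conical commutative monoid ("cone"): `x + y = 0` implies `x = y = 0`. -/
def IsConical (M : Type u) [AddCommMonoid M] : Prop :=
  ∀ x y : M, x + y = 0 → x = 0 ∧ y = 0

/-- Algebraic preorder: `x ≤ y` iff `∃ z, x + z = y`. -/
def AlgLE {M : Type u} [AddCommMonoid M] (x y : M) : Prop :=
  ∃ z : M, x + z = y

/-- Refinement monoid. -/
def IsRefinementMonoid (M : Type u) [AddCommMonoid M] : Prop :=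
  ∀ a₀ a₁ b₀ b₁ : M, a₀ + a₁ = b₀ + b₁ →
    ∃ c₀₀ c₀₁ c₁₀ c₁₁ : M,
      a₀ = c₀₀ + c₀₁ ∧ a₁ = c₁₀ + c₁₁ ∧ b₀ = c₀₀ + c₁₀ ∧ b₁ = c₀₁ + c₁₁

/-- Unitary homomorphism: injective, cofinal image, and `f a₀ + b = f a₁ → b ∈ range f`. -/
def IsUnitary {A : Type u} {B : Type u} [AddCommMonoid A] [AddCommMonoid B]
    (f : A →+ B) : Prop :=
  Function.Injective f ∧
  (∀ b : B, ∃ a : A, AlgLE b (f a)) ∧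
  (∀ a₀ a₁ : A, ∀ b : B, f a₀ + b = f a₁ → b ∈ Set.range f)

/-- Strongly unitary homomorphism. -/
def IsStronglyUnitary {A : Type u} {B : Type u} [AddCommMonoid A] [AddCommMonoid B]
    (f : A →+ B) : Prop :=
  IsUnitary f ∧ ∀ m : ℕ, 0 < m → ∀ b : B, m • b ∈ Set.range f → b ∈ Set.range f

/-- Normally divisible commutative monoid. -/
def IsNormallyDivisible (M : Type u) [AddCommMonoid M] : Prop :=
  ∀ p : ℕ, 0 < p → ∀ X : Finset M, ∀ a : M,
    ∃ u : M, p • u = a ∧ ∀ x ∈ X, ∀ y ∈ X, x + a = y + a → x + u = y + u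

/-- Order-embedding of commutative monoids (w.r.t. the algebraic preorders). -/
def IsOrderEmbeddingHom {A : Type u} {B : Type u} [AddCommMonoid A] [AddCommMonoid B]
    (f : A →+ B) : Prop :=
  Function.Injective f ∧ ∀ x y : A, AlgLE x y ↔ AlgLE (f x) (f y)

/-- Simple commutative monoid: every `u ≰ 0` is an order-unit. -/
def IsSimpleMonoid (M : Type u) [AddCommMonoid M] : Prop :=
  ∀ u : M, ¬ AlgLE u 0 → ∀ x : M, ∃ n : ℕ, 0 < n ∧ AlgLE x (n • u)

/-- Weak sum decomposition axiom (WSD). -/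
def WSD (M : Type u) [AddCommMonoid M] : Prop :=
  ∀ a₀ a₁ b c : M, a₀ + a₁ + c = b + c →
    ∃ x₀ x₁ : M, a₀ + c = x₀ + c ∧ a₁ + c = x₁ + c ∧ b = x₀ + x₁

/-- `a ∝ b` : `a ≤ n • b` for some positive integer `n`. -/
def Propto {M : Type u} [AddCommMonoid M] (a b : M) : Prop :=
  ∃ n : ℕ, 0 < n ∧ AlgLE a (n • b)

/-- `a ≍ b` : `a ∝ b` and `b ∝ a`. -/
def Asymp {M : Type u} [AddCommMonoid M] (a b : M) : Prop :=
  Propto a b ∧ Propto b a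

/-- Cancellative commutative monoid. -/
def IsCancellativeMonoid (M : Type u) [AddCommMonoid M] : Prop :=
  ∀ x y z : M, x + z = y + z → x = y

/-- Separative commutative monoid. -/
def IsSeparative (M : Type u) [AddCommMonoid M] : Prop :=
  ∀ x y : M, 2 • x = x + y → x + y = 2 • y → x = y

/-- Stably finite commutative monoid. -/
def IsStablyFinite (M : Type u) [AddCommMonoid M] : Prop :=
  ∀ x y : M, x + y = y → x = 0

/-- Quasi-divisible commutative monoid. -/
def IsQuasiDivisible (M : Type u) [AddCommMonoid M] : Prop :=
  ∀ x : M, ∃ u v : M, 2 • u + 3 • v = x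

/-- `ℙ`-torsion-free commutative monoid. -/
def PTorsionFree (P : Set ℕ) (M : Type u) [AddCommMonoid M] : Prop :=
  ∀ p ∈ P, ∀ x y : M, p • x = p • y → x = y

/-- `ℙ`-unperforated commutative monoid (w.r.t. the algebraic preorder). -/
def PUnperforated (P : Set ℕ) (M : Type u) [AddCommMonoid M] : Prop :=
  ∀ p ∈ P, ∀ x y : M, AlgLE (p • x) (p • y) → AlgLE x y

namespace IsConical

variable {M : Type u} [AddCommMonoid M]

theorem prod {M N : Type*} [AddCommMonoid M] [AddCommMonoid N] (hM : IsConical M) (hN : IsConical N) :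
    IsConical (M × N) := fun x y h =>
  have h₁ := hM x.1 y.1 (congrArg Prod.fst h)
  have h₂ := hN x.2 y.2 (congrArg Prod.snd h)
  ⟨Prod.ext h₁.1 h₂.1, Prod.ext h₁.2 h₂.2⟩

theorem finsupp {ι M : Type*} [AddCommMonoid M] (hM : IsConical M) : IsConical (ι →₀ M) := fun x y h =>
  have h' (i : ι) := hM (x i) (y i) (DFunLike.congr_fun h i)
  ⟨Finsupp.ext fun i => (h' i).1, Finsupp.ext fun i => (h' i).2⟩

theorem eq_zero_of_nsmul (hM : IsConical M) {k : ℕ} {a : M} (ha : a ≠ 0) (h : k • a = 0) :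
    k = 0 := by
  cases k with
  | zero => rfl
  | succ k => exact absurd (hM _ _ ((succ_nsmul a k).symm.trans h)).2 ha

theorem eq_zero_of_sum (hM : IsConical M) {ι : Type u} {s : Finset ι} {c : ι → M}
    (h : ∑ i ∈ s, c i = 0) : ∀ i ∈ s, c i = 0 := by
  classical
  induction s using Finset.induction_on with
  | empty => simp
  | insert i s hi ih =>
    rw [Finset.sum_insert hi] at h
    have h' := hM _ _ h
    intro j hj
    rcases Finset.mem_insert.1 hj with rfl | hj
    · exact h'.1
    · exact ih h'.2 j hj

end IsConical

namespace IsUnitary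

variable {A B C : Type u} [AddCommMonoid A] [AddCommMonoid B] [AddCommMonoid C]

theorem id : IsUnitary (AddMonoidHom.id A) :=
  ⟨fun _ _ h => h, fun b => ⟨b, 0, add_zero b⟩, fun _ _ b _ => ⟨b, rfl⟩⟩

theorem comp {g : B →+ C} {f : A →+ B} (hg : IsUnitary g) (hf : IsUnitary f) :
    IsUnitary (g.comp f) := by
  refine ⟨hg.1.comp hf.1, fun c => ?_, fun a₀ a₁ c h => ?_⟩
  · obtain ⟨b, z, hz⟩ := hg.2.1 c
    obtain ⟨a, w, hw⟩ := hf.2.1 b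
    exact ⟨a, z + g w, by rw [← add_assoc, hz, ← map_add, hw]; rfl⟩
  · obtain ⟨b, rfl⟩ := hg.2.2 _ _ _ h
    obtain ⟨a, rfl⟩ := hf.2.2 a₀ a₁ b (hg.1 (by simpa using h))
    exact ⟨a, rfl⟩

end IsUnitary

namespace IsStronglyUnitary

variable {A B C : Type u} [AddCommMonoid A] [AddCommMonoid B] [AddCommMonoid C]

theorem id : IsStronglyUnitary (AddMonoidHom.id A) :=
  ⟨IsUnitary.id, fun _ _ b _ => ⟨b, rfl⟩⟩

theorem comp {g : B →+ C} {f : A →+ B} (hg : IsStronglyUnitary g) (hf : IsStronglyUnitary f) :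
    IsStronglyUnitary (g.comp f) := by
  refine ⟨hg.1.comp hf.1, fun m hm c ⟨a, ha⟩ => ?_⟩
  obtain ⟨b, rfl⟩ := hg.2 m hm c ⟨f a, ha⟩
  obtain ⟨a', rfl⟩ := hf.2 m hm b ⟨a, hg.1.1 (by simpa using ha)⟩
  exact ⟨a', rfl⟩

end IsStronglyUnitary

/-- Every equation `a₀ + a₁ = b₀ + b₁` in the domain of `f` has a refinement in the codomain. -/
def RefinesThrough {A B : Type u} [AddCommMonoid A] [AddCommMonoid B] (f : A →+ B) : Prop :=
  ∀ a₀ a₁ b₀ b₁ : A, a₀ + a₁ = b₀ + b₁ → ∃ c₀₀ c₀₁ c₁₀ c₁₁ : B,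
    f a₀ = c₀₀ + c₀₁ ∧ f a₁ = c₁₀ + c₁₁ ∧ f b₀ = c₀₀ + c₁₀ ∧ f b₁ = c₀₁ + c₁₁

/-- Every element of the domain of `f` is divisible in the codomain by all positive integers. -/
def DividesThrough {A B : Type u} [AddCommMonoid A] [AddCommMonoid B] (f : A →+ B) : Prop :=
  ∀ p : ℕ, 0 < p → ∀ a : A, ∃ u : B, p • u = f a

section Limit

variable {T : ℕ → Type u} [∀ n, AddCommMonoid (T n)]

/-- The transition maps of the tower generated by `f n : T n →+ T (n + 1)`. -/
def towerMap (f : ∀ n, T n →+ T (n + 1)) (i j : ℕ) (h : i ≤ j) : T i →+ T j :=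
  Nat.leRec (motive := fun m _ => T i →+ T m) (AddMonoidHom.id _) (fun k _ g => (f k).comp g) h

theorem towerMap_self (f : ∀ n, T n →+ T (n + 1)) (i : ℕ) :
    towerMap f i i le_rfl = AddMonoidHom.id _ :=
  Nat.leRec_self _ _

theorem towerMap_succ (f : ∀ n, T n →+ T (n + 1)) (i j : ℕ) (h : i ≤ j) :
    towerMap f i (j + 1) (Nat.le_succ_of_le h) = (f j).comp (towerMap f i j h) :=
  Nat.leRec_succ _ _ h

theorem towerMap_comp (f : ∀ n, T n →+ T (n + 1)) (i j k : ℕ) (hij : i ≤ j) (hjk : j ≤ k) :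
    (towerMap f j k hjk).comp (towerMap f i j hij) = towerMap f i k (hij.trans hjk) := by
  induction k, hjk using Nat.le_induction with
  | base => rw [towerMap_self]; rfl
  | succ k hjk ih => rw [towerMap_succ, towerMap_succ f i k (hij.trans hjk), ← ih]; rfl

theorem towerMap_induction (f : ∀ n, T n →+ T (n + 1))
    {P : ∀ i j : ℕ, (T i →+ T j) → Prop} (hid : ∀ i, P i i (AddMonoidHom.id _))
    (hcomp : ∀ i j (g : T i →+ T j), P i j g → P i (j + 1) ((f j).comp g))
    (i j : ℕ) (h : i ≤ j) : P i j (towerMap f i j h) := by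
  induction j, h using Nat.le_induction with
  | base => rw [towerMap_self]; exact hid i
  | succ j h ih => rw [towerMap_succ f i j h]; exact hcomp _ _ _ ih

instance towerMap_directedSystem (f : ∀ n, T n →+ T (n + 1)) :
    DirectedSystem T (fun i j h => towerMap f i j h) where
  map_self i x := by rw [towerMap_self]; rfl
  map_map k j i hij hjk x := DFunLike.congr_fun (towerMap_comp f i j k hij hjk) x

/-- A tower of unitary embeddings of cancellative cones has a colimit with the same properties. -/
theorem exists_tower_colimit (f : ∀ n, T n →+ T (n + 1)) (hcon : ∀ n, IsConical (T n))
    (hcan : ∀ n, IsCancellativeMonoid (T n)) (hf : ∀ n, IsUnitary (f n)) :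
    ∃ (N : Type u) (_ : AddCommMonoid N) (φ : ∀ n, T n →+ N),
      IsConical N ∧ IsCancellativeMonoid N ∧ (∀ n, (φ (n + 1)).comp (f n) = φ n) ∧
      (∀ n, IsUnitary (φ n)) ∧ ((∀ n, IsStronglyUnitary (f n)) → ∀ n, IsStronglyUnitary (φ n)) ∧
      ∀ x : N, ∃ n, ∀ m ≥ n, x ∈ Set.range (φ m) := by
  have hunit : ∀ i j h, IsUnitary (towerMap f i j h) :=
    towerMap_induction f (P := fun _ _ g => IsUnitary g) (fun _ => IsUnitary.id)
      fun _ j _ hg => (hf j).comp hg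
  let φ (n : ℕ) : T n →+ DirectLimit T (towerMap f) :=
    { toFun := fun x => ⟦⟨n, x⟩⟧
      map_zero' := (DirectLimit.zero_def n).symm
      map_add' := fun x y => (DirectLimit.add_def n x y).symm }
  have hφ (i j : ℕ) (h : i ≤ j) (x : T i) : φ j (towerMap f i j h x) = φ i x :=
    DirectLimit.mk_apply i j x h
  have hinj (n : ℕ) : Function.Injective (φ n) :=
    DirectLimit.mk_injective _ (fun i j h => (hunit i j h).1) n
  have hsurj : ∀ x, ∃ n, ∀ m ≥ n, x ∈ Set.range (φ m) :=
    DirectLimit.induction _ fun i x => ⟨i, fun m hm => ⟨towerMap f i m hm x, hφ i m hm x⟩⟩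
  have hlift (n : ℕ) (x) : ∃ m, ∃ h : n ≤ m, ∃ y : T m, φ m y = x ∧
      ∀ a, φ m (towerMap f n m h a) = φ n a := by
    obtain ⟨k, hk⟩ := hsurj x
    obtain ⟨y, hy⟩ := hk (max n k) (le_max_right _ _)
    exact ⟨max n k, le_max_left _ _, y, hy, hφ _ _ _⟩
  have hφu (n : ℕ) : IsUnitary (φ n) := by
    refine ⟨hinj n, fun x => ?_, fun a₀ a₁ x h => ?_⟩
    · obtain ⟨m, hnm, y, rfl, hm⟩ := hlift n x
      obtain ⟨a, z, hz⟩ := (hunit n m hnm).2.1 y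
      exact ⟨a, φ m z, by rw [← map_add, hz, hm]⟩
    · obtain ⟨m, hnm, y, rfl, hm⟩ := hlift n x
      rw [← hm, ← hm, ← map_add] at h
      obtain ⟨a, rfl⟩ := (hunit n m hnm).2.2 _ _ _ (hinj m h)
      exact ⟨a, (hm a).symm⟩
  refine ⟨DirectLimit T (towerMap f), inferInstance, φ, ?_, ?_, fun n => ?_, hφu,
    fun hs n => ⟨hφu n, fun k hk x ⟨a, ha⟩ => ?_⟩, hsurj⟩
  · refine DirectLimit.induction₂ _ fun i x y (h : φ i x + φ i y = 0) => ?_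
    rw [← map_add, ← map_zero (φ i)] at h
    have h' := hcon i x y (hinj i h)
    exact ⟨(congrArg (φ i) h'.1).trans (map_zero _), (congrArg (φ i) h'.2).trans (map_zero _)⟩
  · refine DirectLimit.induction₃ _ fun i x y z (h : φ i x + φ i z = φ i y + φ i z) => ?_
    rw [← map_add, ← map_add] at h
    exact congrArg (φ i) (hcan i x y z (hinj i h))
  · ext x
    have h := hφ n (n + 1) n.le_succ x
    rwa [towerMap_succ f n n le_rfl, towerMap_self] at h
  · obtain ⟨m, hnm, y, rfl, hm⟩ := hlift n x
    have hst : IsStronglyUnitary (towerMap f n m hnm) :=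
      towerMap_induction f (P := fun _ _ g => IsStronglyUnitary g) (fun _ => IsStronglyUnitary.id)
        (fun _ j _ hg => (hs j).comp hg) n m hnm
    rw [← hm, ← map_nsmul] at ha
    obtain ⟨a', rfl⟩ := hst.2 k hk y ⟨a, hinj m ha⟩
    exact ⟨a', (hm a').symm⟩

end Limit

/-- A cancellative cone, bundled. -/
structure CancCone where
  carrier : Type u
  [inst : AddCommMonoid carrier]
  conical : IsConical carrier
  canc : IsCancellativeMonoid carrier

attribute [instance] CancCone.inst

/-- The tower obtained from `X` by iterating `S`. -/
def CancCone.iterate (S : CancCone.{u} → CancCone.{u}) (X : CancCone.{u}) : ℕ → CancCone.{u}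
  | 0 => X
  | n + 1 => S (iterate S X n)

/-- Iterating one-step unitary embeddings with property `K` gives a cancellative cone in which
every finite set of elements comes from the domain of an embedding with property `K`. -/
theorem exists_closed_extension
    (K : ∀ (A B : Type u) [AddCommMonoid A] [AddCommMonoid B], (A →+ B) → Prop)
    (step : ∀ (A : Type u) [AddCommMonoid A], IsConical A → IsCancellativeMonoid A →
      ∃ (B : Type u) (_ : AddCommMonoid B) (f : A →+ B),
        IsConical B ∧ IsCancellativeMonoid B ∧ IsUnitary f ∧ K A B f)
    (M : Type u) [AddCommMonoid M] (hM : IsConical M) (hMc : IsCancellativeMonoid M) :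
    ∃ (N : Type u) (_ : AddCommMonoid N) (f : M →+ N),
      IsConical N ∧ IsCancellativeMonoid N ∧ IsUnitary f ∧
      ((∀ (A B : Type u) [AddCommMonoid A] [AddCommMonoid B] (g : A →+ B), K A B g →
        IsStronglyUnitary g) → IsStronglyUnitary f) ∧
      ∀ s : Finset N, ∃ (A B : Type u) (_ : AddCommMonoid A) (_ : AddCommMonoid B)
        (g : A →+ B) (β : B →+ N), K A B g ∧ Function.Injective (β.comp g) ∧
          ∀ x ∈ s, ∃ a, β (g a) = x := by
  have step' (X : CancCone.{u}) : ∃ (Y : CancCone.{u}) (f : X.carrier →+ Y.carrier),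
      IsUnitary f ∧ K _ _ f := by
    obtain ⟨B, _, f, hB, hBc, hf⟩ := step X.carrier X.conical X.canc
    exact ⟨⟨B, hB, hBc⟩, f, hf⟩
  choose S F hunit hK using step'
  let T := CancCone.iterate S ⟨M, hM, hMc⟩
  let f (n : ℕ) : (T n).carrier →+ (T (n + 1)).carrier := F (T n)
  obtain ⟨N, _, φ, hN, hNc, hcomp, hφ, hstrong, hsurj⟩ :=
    exists_tower_colimit f (fun n => (T n).conical) (fun n => (T n).canc) fun n => hunit (T n)
  refine ⟨N, inferInstance, φ 0, hN, hNc, hφ 0,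
    fun h => hstrong (fun n => h _ _ _ (hK (T n))) 0, fun s => ?_⟩
  have hs : ∀ᶠ m in Filter.atTop, ∀ x ∈ s, x ∈ Set.range (φ m) :=
    (Filter.eventually_all_finset s).2 fun x _ => Filter.eventually_atTop.2 (hsurj x)
  obtain ⟨m, hm⟩ := hs.exists
  refine ⟨(T m).carrier, (T (m + 1)).carrier, inferInstance, inferInstance, f m, φ (m + 1),
    hK (T m), ?_, fun x hx => ?_⟩
  · simpa only [hcomp m] using (hφ m).1
  · obtain ⟨a, ha⟩ := hm x hx
    exact ⟨a, by rw [← ha, ← hcomp m]; rfl⟩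

/-- The submonoid generated by a cone `M` and new generators `σ n` in an abelian group. -/
theorem exists_unitary_extension {M F H : Type u} [AddCommMonoid M] [AddCommMonoid F]
    [AddCommGroup H] (hM : IsConical M) (hF : IsConical F) (j : M →+ H) (σ : F →+ H)
    (h : ∀ a b n, j a + σ n = j b → ∃ c, b = a + c ∧ (c = 0 → n = 0))
    (hcof : ∀ n, ∃ n' a, σ n + σ n' = j a) :
    ∃ (N : Type u) (_ : AddCommMonoid N) (f : M →+ N) (g : F →+ N) (e : N →+ H),
      IsConical N ∧ IsCancellativeMonoid N ∧ IsUnitary f ∧ Function.Injective e ∧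
      (∀ x, e (f x) = j x) ∧ (∀ n, e (g n) = σ n) ∧ ∀ y, ∃ x n, y = f x + g n := by
  have hj : Function.Injective j := fun a b hab => by
    obtain ⟨c, rfl, -⟩ := h a b 0 (by simpa using hab)
    obtain ⟨d, hd, -⟩ := h c 0 0 (by simpa using hab)
    rw [(hM c d hd.symm).1, add_zero]
  let P := j.coprod σ
  let f : M →+ AddMonoidHom.mrange P := P.mrangeRestrict.comp (AddMonoidHom.inl M F)
  let g : F →+ AddMonoidHom.mrange P := P.mrangeRestrict.comp (AddMonoidHom.inr M F)
  let e := (AddMonoidHom.mrange P).subtype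
  have he : Function.Injective e := Subtype.val_injective
  have hf (x) : e (f x) = j x := by simp [e, f, P]
  have hg (n) : e (g n) = σ n := by simp [e, g, P]
  have hsurj (y) : ∃ x n, y = f x + g n := by
    obtain ⟨_, ⟨x, n⟩, rfl⟩ := y
    exact ⟨x, n, he (by rw [map_add, hf, hg]; simp [e, P])⟩
  refine ⟨AddMonoidHom.mrange P, inferInstance, f, g, e, fun y y' hyy => ?_, fun x y z hxyz => ?_,
    ⟨fun a b hab => ?_, fun y => ?_, fun a b y hy => ?_⟩, he, hf, hg, hsurj⟩
  · obtain ⟨x, n, rfl⟩ := hsurj y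
    obtain ⟨x', n', rfl⟩ := hsurj y'
    rw [add_add_add_comm, ← map_add, ← map_add] at hyy
    have hyy' := congrArg e hyy
    rw [map_add, hf, hg, map_zero, ← map_zero j] at hyy'
    obtain ⟨c, hc, hn⟩ := h _ _ _ hyy'
    obtain ⟨hx, rfl⟩ := hM _ _ hc.symm
    have h₁ := hM _ _ hx
    have h₂ := hF _ _ (hn rfl)
    simp [h₁, h₂]
  · have := congrArg e hxyz
    rw [map_add, map_add] at this
    exact he (add_right_cancel this)
  · exact hj (by rw [← hf, ← hf, hab])
  · obtain ⟨x, n, rfl⟩ := hsurj y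
    obtain ⟨n', a, hn⟩ := hcof n
    exact ⟨x + a, g n', he (by simp only [map_add, hf, hg, add_assoc, hn])⟩
  · obtain ⟨x, n, rfl⟩ := hsurj y
    have hy' := congrArg e hy
    rw [map_add, map_add, hf, hf, hf, hg, ← add_assoc, ← map_add] at hy'
    obtain ⟨c, rfl, -⟩ := h _ _ _ hy'
    refine ⟨x + c, he ?_⟩
    rw [add_assoc, map_add j a, map_add j a, add_assoc] at hy'
    rw [hf, map_add e, hf, hg]
    exact (add_left_cancel hy').symm

theorem IsCancellativeMonoid.of_injective {M : Type u} [AddCommMonoid M]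
    (hMc : IsCancellativeMonoid M) :
    Function.Injective (Algebra.GrothendieckAddGroup.of : M →+ _) := by
  have : IsRightCancelAdd M := ⟨fun z _ _ h => hMc _ _ z h⟩
  have : IsCancelAdd M := AddCommMagma.IsRightCancelAdd.toIsCancelAdd M
  exact Algebra.GrothendieckAddGroup.of_injective

/-- Adjoining `p`-th parts of all nonzero elements of a cancellative cone. -/
theorem exists_divisible_step (M : Type u) [AddCommMonoid M] (hM : IsConical M)
    (hMc : IsCancellativeMonoid M) :
    ∃ (N : Type u) (_ : AddCommMonoid N) (f : M →+ N),
      IsConical N ∧ IsCancellativeMonoid N ∧ IsUnitary f ∧ DividesThrough f := by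
  classical
  let G := Algebra.GrothendieckAddGroup M
  let ι : M →+ G := Algebra.GrothendieckAddGroup.of
  have hι : Function.Injective ι := hMc.of_injective
  let D := {d : ℕ × M // 0 < d.1 ∧ d.2 ≠ 0}
  let κ : (D →₀ ℤ) →+ G × (D →₀ ℤ) := Finsupp.liftAddHom fun d =>
    (zmultiplesHom _) (-ι d.1.2, Finsupp.single d (d.1.1 : ℤ))
  have hκ₁ (k : D →₀ ℤ) : (κ k).1 = -k.sum fun d z => z • ι d.1.2 := by
    induction k using Finsupp.induction_linear with
    | zero => simp
    | add x y hx hy =>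
      rw [map_add, Prod.fst_add, hx, hy, Finsupp.sum_add_index' (by simp) (by simp [add_smul]),
        neg_add]
    | single d z => simp [κ]
  have hκ₂ (k : D →₀ ℤ) (d : D) : (κ k).2 d = k d * d.1.1 := by
    induction k using Finsupp.induction_linear with
    | zero => simp
    | add x y hx hy => simp [hx, hy, add_mul]
    | single d' z =>
      by_cases h : d' = d
      · subst h; simp [κ]
      · simp [κ, h]
  have hnat : IsConical ℕ := fun x y h => by omega
  let q := QuotientAddGroup.mk' κ.range
  let j : M →+ (G × (D →₀ ℤ)) ⧸ κ.range := q.comp ((AddMonoidHom.inl _ _).comp ι)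
  let σ : (D →₀ ℕ) →+ (G × (D →₀ ℤ)) ⧸ κ.range :=
    q.comp ((AddMonoidHom.inr _ _).comp (Finsupp.mapRange.addMonoidHom (Nat.castAddMonoidHom ℤ)))
  have hσ (d : D) : d.1.1 • σ (Finsupp.single d 1) = j d.1.2 := by
    rw [← map_nsmul]
    refine QuotientAddGroup.eq.2 ⟨Finsupp.single d (-1), ?_⟩
    rw [Finsupp.liftAddHom_apply_single]
    refine Prod.ext ?_ ?_ <;> simp
    exact neg_neg (ι d.1.2)
  have hstar (a b : M) (n : D →₀ ℕ) (hab : j a + σ n = j b) :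
      ∃ c, b = a + c ∧ (c = 0 → n = 0) := by
    obtain ⟨k, hk⟩ := QuotientAddGroup.eq.1 (show q _ = q _ by
      simpa only [j, σ, AddMonoidHom.comp_apply, ← map_add q] using hab)
    have h₂ (d : D) : k d * d.1.1 = -(n d : ℤ) := by rw [← hκ₂, hk]; simp
    have hneg (d : D) : k d ≤ 0 := by
      have hp : (0 : ℤ) < d.1.1 := by exact_mod_cast d.2.1
      nlinarith [h₂ d, (n d).cast_nonneg (α := ℤ)]
    have h₁ : ι b = ι a + k.sum fun d z => -z • ι d.1.2 := by
      have := (hκ₁ k).symm.trans (congrArg Prod.fst hk)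
      simp only [neg_smul, Finsupp.sum_neg]
      rw [this]; simp
    refine ⟨k.sum fun d z => z.natAbs • d.1.2, hι ?_, fun hc => ?_⟩
    · rw [h₁, map_add, map_finsuppSum]
      congr 1
      refine Finsupp.sum_congr fun d _ => ?_
      rw [map_nsmul, ← natCast_zsmul, Int.ofNat_natAbs_of_nonpos (hneg d)]
    · ext d
      have hkd : k d = 0 := by
        by_contra hd
        have := hM.eq_zero_of_nsmul d.2.2
          (hM.eq_zero_of_sum hc d (Finsupp.mem_support_iff.2 hd))
        omega
      have := h₂ d
      rw [hkd] at this
      simp only [Finsupp.coe_zero, Pi.zero_apply]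
      omega
  have hcof (n : D →₀ ℕ) : ∃ n' a, σ n + σ n' = j a := by
    induction n using Finsupp.induction_linear with
    | zero => exact ⟨0, 0, by simp⟩
    | add x y hx hy =>
      obtain ⟨x', a, hx⟩ := hx
      obtain ⟨y', b, hy⟩ := hy
      exact ⟨x' + y', a + b, by rw [map_add, map_add, map_add, ← hx, ← hy, add_add_add_comm]⟩
    | single d z =>
      refine ⟨Finsupp.single d (z * (d.1.1 - 1)), z • d.1.2, ?_⟩
      have hz : Finsupp.single d z + Finsupp.single d (z * (d.1.1 - 1)) =
          (z * d.1.1) • Finsupp.single d 1 := by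
        obtain ⟨r, hr⟩ := Nat.exists_eq_add_of_lt d.2.1
        rw [← Finsupp.single_add, Finsupp.smul_single, hr]
        simp [mul_add, add_comm]
      rw [← map_add, hz, map_nsmul, mul_smul, hσ, map_nsmul]
  obtain ⟨N, _, f, g, e, hN, hNc, hf, he, hef, heg, -⟩ :=
    exists_unitary_extension hM (IsConical.finsupp hnat) j σ hstar hcof
  refine ⟨N, inferInstance, f, hN, hNc, hf, fun p hp a => ?_⟩
  by_cases ha : a = 0
  · exact ⟨0, by simp [ha]⟩
  · exact ⟨g (Finsupp.single ⟨(p, a), hp, ha⟩ 1), he (by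
      rw [map_nsmul, heg, hef]; exact hσ ⟨(p, a), hp, ha⟩)⟩

/-- Formal natural combinations of the entries `((c₀₀, c₀₁), (c₁₀, c₁₁))` of a refinement. -/
abbrev EntryCombination := (ℕ × ℕ) × ℕ × ℕ

/-- Adjoining refinements of all equations between nonzero elements of a cancellative cone. -/
theorem exists_refinement_step (M : Type u) [AddCommMonoid M] (hM : IsConical M)
    (hMc : IsCancellativeMonoid M) :
    ∃ (N : Type u) (_ : AddCommMonoid N) (f : M →+ N),
      IsConical N ∧ IsCancellativeMonoid N ∧ IsStronglyUnitary f ∧ RefinesThrough f := by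
  classical
  let G := Algebra.GrothendieckAddGroup M
  let ι : M →+ G := Algebra.GrothendieckAddGroup.of
  have hι : Function.Injective ι := hMc.of_injective
  let E := {r : (M × M) × M × M // r.1.1 + r.1.2 = r.2.1 + r.2.2 ∧
    r.1.1 ≠ 0 ∧ r.1.2 ≠ 0 ∧ r.2.1 ≠ 0 ∧ r.2.2 ≠ 0}
  let θ (r : E) : EntryCombination →+ G × (E →₀ ℤ) :=
    ((multiplesHom _ (0, Finsupp.single r 1)).coprod
      (multiplesHom _ (ι r.1.1.1, Finsupp.single r (-1)))).coprod
    ((multiplesHom _ (ι r.1.2.1, Finsupp.single r (-1))).coprod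
      (multiplesHom _ (ι r.1.1.2 - ι r.1.2.1, Finsupp.single r 1)))
  let σ : (E →₀ EntryCombination) →+ G × (E →₀ ℤ) := Finsupp.liftAddHom θ
  let j : M →+ G × (E →₀ ℤ) := (AddMonoidHom.inl _ _).comp ι
  have hσs (r : E) (v : EntryCombination) : σ (Finsupp.single r v) = θ r v := by simp [σ]
  have hθ₁ (r : E) (n₁ n₂ n₃ n₄ : ℕ) : (θ r ((n₁, n₂), n₃, n₄)).1 =
      n₂ • ι r.1.1.1 + (n₃ • ι r.1.2.1 + n₄ • (ι r.1.1.2 - ι r.1.2.1)) := by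
    simp [θ]
  have hθ₂ (r : E) (v : EntryCombination) : (θ r v).2 =
      Finsupp.single r ((v.1.1 : ℤ) - v.1.2 - v.2.1 + v.2.2) := by
    obtain ⟨⟨n₁, n₂⟩, n₃, n₄⟩ := v
    simp only [θ, AddMonoidHom.coprod_apply, multiplesHom_apply, Prod.snd_add, Prod.smul_snd,
      Finsupp.smul_single, ← Finsupp.single_add]
    congr 1
    simp only [nsmul_eq_mul]
    ring
  have hσ₁ (n : E →₀ EntryCombination) : (σ n).1 = n.sum fun r v => (θ r v).1 := by
    rw [show σ n = n.sum fun r v => θ r v from rfl]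
    exact map_finsuppSum (AddMonoidHom.fst G (E →₀ ℤ)) n _
  have hσ₂ (n : E →₀ EntryCombination) (r : E) : (σ n).2 r =
      ((n r).1.1 : ℤ) - (n r).1.2 - (n r).2.1 + (n r).2.2 := by
    induction n using Finsupp.induction_linear with
    | zero => simp
    | add x y hx hy => 
      rw [map_add, Prod.snd_add, Finsupp.add_apply, hx, hy, Finsupp.add_apply]
      push_cast [Prod.fst_add, Prod.snd_add]
      ring
    | single s v =>
      rw [hσs, hθ₂]
      by_cases h : s = r
      · subst h; simp
      · simp [h]
  have hlocal (r : E) (v : EntryCombination) (hv : (v.1.1 : ℤ) - v.1.2 - v.2.1 + v.2.2 = 0) :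
      ∃ c : M, ι c = (θ r v).1 ∧ (c = 0 → v = 0) := by
    obtain ⟨⟨⟨a₀, a₁⟩, b₀, b₁⟩, hr, ha₀, ha₁, hb₀, hb₁⟩ := r
    obtain ⟨⟨n₁, n₂⟩, n₃, n₄⟩ := v
    simp only at hr ha₀ ha₁ hb₀ hb₁ hv
    have hr' : ι a₀ + ι a₁ = ι b₀ + ι b₁ := by rw [← map_add, ← map_add, hr]
    rcases le_total n₄ n₃ with h | h
    · obtain ⟨k, rfl⟩ := Nat.exists_eq_add_of_le h
      obtain rfl : n₁ = n₂ + k := by omega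
      refine ⟨n₂ • a₀ + k • b₀ + n₄ • a₁, ?_, fun h0 => ?_⟩
      · rw [hθ₁]; simp only [map_add, map_nsmul, smul_sub, add_smul]; abel
      · have h1 := hM _ _ h0
        have h2 := hM _ _ h1.1
        have e1 := hM.eq_zero_of_nsmul ha₁ h1.2
        have e2 := hM.eq_zero_of_nsmul ha₀ h2.1
        have e3 := hM.eq_zero_of_nsmul hb₀ h2.2
        subst e1 e2 e3; rfl
    · obtain ⟨k, rfl⟩ := Nat.exists_eq_add_of_le h
      obtain rfl : n₂ = n₁ + k := by omega
      refine ⟨n₃ • a₁ + k • b₁ + n₁ • a₀, ?_, fun h0 => ?_⟩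
      · have hb : ι b₁ = ι a₀ + ι a₁ - ι b₀ := by rw [hr']; abel
        rw [hθ₁]; simp only [map_add, map_nsmul, smul_sub, smul_add, add_smul, hb]; abel
      · have h1 := hM _ _ h0
        have h2 := hM _ _ h1.1
        have e1 := hM.eq_zero_of_nsmul ha₀ h1.2
        have e2 := hM.eq_zero_of_nsmul ha₁ h2.1
        have e3 := hM.eq_zero_of_nsmul hb₁ h2.2
        subst e1 e2 e3; rfl
  have hσ (n : E →₀ EntryCombination) (hn : (σ n).2 = 0) : ∃ c, σ n = j c ∧ (c = 0 → n = 0) := by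
    choose μ hμ hμ0 using fun r => hlocal r (n r) (by rw [← hσ₂, hn]; rfl)
    refine ⟨∑ r ∈ n.support, μ r, Prod.ext ?_ hn, fun h0 => ?_⟩
    · rw [hσ₁]
      change _ = ι (∑ r ∈ n.support, μ r)
      rw [map_sum]
      exact Finset.sum_congr rfl fun r _ => (hμ r).symm
    · ext1 r
      by_contra hr
      exact hr (hμ0 r (hM.eq_zero_of_sum h0 r (Finsupp.mem_support_iff.2 hr)))
  have hnat : IsConical ℕ := fun x y h => by omega
  have hstar (a b : M) (n : E →₀ EntryCombination) (hab : j a + σ n = j b) :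
      ∃ c, b = a + c ∧ (c = 0 → n = 0) := by
    have h₂ : (σ n).2 = 0 := by simpa [j] using congrArg Prod.snd hab
    obtain ⟨c, hc, hn⟩ := hσ n h₂
    refine ⟨c, hι ?_, hn⟩
    rw [hc, ← map_add] at hab
    exact (congrArg Prod.fst hab).symm
  have hcof (n : E →₀ EntryCombination) : ∃ n' a, σ n + σ n' = j a := by
    induction n using Finsupp.induction_linear with
    | zero => exact ⟨0, 0, by simp⟩
    | add x y hx hy =>
      obtain ⟨x', a, hx⟩ := hx
      obtain ⟨y', b, hy⟩ := hy
      exact ⟨x' + y', a + b, by rw [map_add, map_add, map_add, ← hx, ← hy, add_add_add_comm]⟩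
    | single r v =>
      obtain ⟨⟨n₁, n₂⟩, n₃, n₄⟩ := v
      refine ⟨Finsupp.single r ((n₂, n₁), n₄, n₃),
        (n₁ + n₂) • r.1.1.1 + (n₃ + n₄) • r.1.1.2, ?_⟩
      rw [hσs, hσs]
      refine Prod.ext ?_ ?_
      · rw [Prod.fst_add, hθ₁, hθ₁]
        change _ = ι _
        simp only [map_add, map_nsmul, add_smul, smul_sub]; abel
      · rw [Prod.snd_add, hθ₂, hθ₂, ← Finsupp.single_add]
        change _ = (0 : E →₀ ℤ)
        rw [Finsupp.single_eq_zero]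
        ring
  obtain ⟨N, _, f, g, e, hN, hNc, hf, he, hef, heg, hsurj⟩ :=
    exists_unitary_extension hM (IsConical.finsupp ((hnat.prod hnat).prod (hnat.prod hnat))) j σ hstar hcof
  refine ⟨N, inferInstance, f, hN, hNc, ⟨hf, fun m hm y ⟨a, ha⟩ => ?_⟩,
    fun a₀ a₁ b₀ b₁ hab => ?_⟩
  · obtain ⟨x, n, rfl⟩ := hsurj y
    have h := congrArg Prod.snd (congrArg e ha)
    rw [map_nsmul, map_add, hef, hef, heg] at h
    have hn : m • (σ n).2 = 0 := by simpa [j] using h.symm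
    obtain ⟨c, hc, -⟩ := hσ n ((smul_eq_zero.1 hn).resolve_left hm.ne')
    exact ⟨x + c, he (by rw [map_add f, map_add, map_add, heg, hef, hef, hc])⟩
  · by_cases ha₀ : a₀ = 0
    · subst ha₀
      rw [zero_add] at hab
      exact ⟨0, 0, f b₀, f b₁, by simp, by rw [hab, map_add], by simp, by simp⟩
    by_cases ha₁ : a₁ = 0
    · subst ha₁
      rw [add_zero] at hab
      exact ⟨f b₀, f b₁, 0, 0, by rw [hab, map_add], by simp, by simp, by simp⟩
    by_cases hb₀ : b₀ = 0
    · subst hb₀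
      rw [zero_add] at hab
      exact ⟨0, f a₀, 0, f a₁, by simp, by simp, by simp, by rw [← hab, map_add]⟩
    by_cases hb₁ : b₁ = 0
    · subst hb₁
      rw [add_zero] at hab
      exact ⟨f a₀, 0, f a₁, 0, by simp, by simp, by rw [← hab, map_add], by simp⟩
    let r : E := ⟨((a₀, a₁), b₀, b₁), hab, ha₀, ha₁, hb₀, hb₁⟩
    have hab' : ι b₁ = ι a₀ + (ι a₁ - ι b₀) := by
      rw [← add_sub_assoc, ← map_add, hab, map_add]; abel
    refine ⟨g (Finsupp.single r ((1, 0), 0, 0)), g (Finsupp.single r ((0, 1), 0, 0)),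
      g (Finsupp.single r ((0, 0), 1, 0)), g (Finsupp.single r ((0, 0), 0, 1)),
      he ?_, he ?_, he ?_, he ?_⟩ <;> rw [map_add, heg, heg, hef, hσs, hσs] <;>
      refine Prod.ext ?_ ?_ <;> simp [hθ₁, hθ₂, j, r, hab']

theorem RefinesThrough.comp_right {A B C : Type u} [AddCommMonoid A] [AddCommMonoid B]
    [AddCommMonoid C] {g : B →+ C} (hg : RefinesThrough g) (f : A →+ B) :
    RefinesThrough (g.comp f) := fun a₀ a₁ b₀ b₁ h =>
  hg (f a₀) (f a₁) (f b₀) (f b₁) (by rw [← map_add, ← map_add, h])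

theorem DividesThrough.comp_left {A B C : Type u} [AddCommMonoid A] [AddCommMonoid B]
    [AddCommMonoid C] {f : A →+ B} (hf : DividesThrough f) (g : B →+ C) :
    DividesThrough (g.comp f) := fun p hp a => by
  obtain ⟨u, hu⟩ := hf p hp a
  exact ⟨g u, by rw [← map_nsmul, hu]; rfl⟩

theorem isRefinementMonoid_of_local {N : Type u} [AddCommMonoid N]
    (h : ∀ s : Finset N, ∃ (A B : Type u) (_ : AddCommMonoid A) (_ : AddCommMonoid B)
      (g : A →+ B) (β : B →+ N), RefinesThrough g ∧ Function.Injective (β.comp g) ∧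
        ∀ x ∈ s, ∃ a, β (g a) = x) : IsRefinementMonoid N := by
  classical
  intro a₀ a₁ b₀ b₁ hab
  obtain ⟨A, B, _, _, g, β, hg, hinj, hs⟩ := h {a₀, a₁, b₀, b₁}
  obtain ⟨a₀, rfl⟩ := hs a₀ (by simp)
  obtain ⟨a₁, rfl⟩ := hs a₁ (by simp)
  obtain ⟨b₀, rfl⟩ := hs b₀ (by simp)
  obtain ⟨b₁, rfl⟩ := hs b₁ (by simp)
  obtain ⟨c₀₀, c₀₁, c₁₀, c₁₁, h₁, h₂, h₃, h₄⟩ := hg a₀ a₁ b₀ b₁ (hinj (by simpa using hab))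
  exact ⟨β c₀₀, β c₀₁, β c₁₀, β c₁₁, by simp [h₁], by simp [h₂], by simp [h₃], by simp [h₄]⟩

theorem exists_divisible_refinement_step (M : Type u) [AddCommMonoid M] (hM : IsConical M)
    (hMc : IsCancellativeMonoid M) :
    ∃ (N : Type u) (_ : AddCommMonoid N) (f : M →+ N),
      IsConical N ∧ IsCancellativeMonoid N ∧ IsUnitary f ∧ DividesThrough f ∧
        RefinesThrough f := by
  obtain ⟨B, _, f, hB, hBc, hf, hdiv⟩ := exists_divisible_step M hM hMc
  obtain ⟨C, _, g, hC, hCc, hg, href⟩ := exists_refinement_step B hB hBc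
  exact ⟨C, inferInstance, g.comp f, hC, hCc, hg.1.comp hf, hdiv.comp_left g, href.comp_right f⟩

/-- Every cancellative cone admits a unitary embedding into a cancellative
normally divisible refinement cone, and also a strongly unitary embedding into a
cancellative refinement cone. -/
theorem cancellative_cone_embeddings
    (M : Type u) [AddCommMonoid M] (hM : IsConical M) (hMc : IsCancellativeMonoid M) :
    (∃ (N : Type u) (_ : AddCommMonoid N),
      IsConical N ∧ IsCancellativeMonoid N ∧ IsNormallyDivisible N ∧ IsRefinementMonoid N ∧
      ∃ f : M →+ N, IsUnitary f) ∧
    (∃ (N : Type u) (_ : AddCommMonoid N),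
      IsConical N ∧ IsCancellativeMonoid N ∧ IsRefinementMonoid N ∧
      ∃ f : M →+ N, IsStronglyUnitary f) := by
  constructor
  · obtain ⟨N, _, f, hN, hNc, hf, -, hloc⟩ := exists_closed_extension
      (fun _ _ _ _ g => DividesThrough g ∧ RefinesThrough g)
      (fun A _ hA hAc => exists_divisible_refinement_step A hA hAc) M hM hMc
    refine ⟨N, inferInstance, hN, hNc, fun p hp X a => ?_,
      isRefinementMonoid_of_local fun s => ?_, f, hf⟩
    · obtain ⟨A, B, _, _, g, β, hg, -, hs⟩ := hloc {a}
      obtain ⟨a', rfl⟩ := hs a (by simp)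
      obtain ⟨u, hu⟩ := hg.1 p hp a'
      exact ⟨β u, by rw [← map_nsmul, hu], fun x _ y _ hxy => by rw [hNc x y _ hxy]⟩
    · obtain ⟨A, B, _, _, g, β, hg, h⟩ := hloc s
      exact ⟨A, B, _, _, g, β, hg.2, h⟩
  · obtain ⟨N, _, f, hN, hNc, -, hf, hloc⟩ := exists_closed_extension
      (fun _ _ _ _ g => IsStronglyUnitary g ∧ RefinesThrough g)
      (fun A _ hA hAc => by
        obtain ⟨B, _, f, hB, hBc, hf, href⟩ := exists_refinement_step A hA hAc
        exact ⟨B, inferInstance, f, hB, hBc, hf.1, hf, href⟩) M hM hMc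
    refine ⟨N, inferInstance, hN, hNc, isRefinementMonoid_of_local fun s => ?_, f,
      hf fun _ _ _ _ _ hg => hg.1⟩
    obtain ⟨A, B, _, _, g, β, hg, h⟩ := hloc s
    exact ⟨A, B, _, _, g, β, hg.2, h⟩
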